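/- Let μ, ν be probability measures with finite first moment on the space of positive definite matrices, X, Y positive definite, and t, s ∈ [0,1]. Then d₁^W(X #_t μ, Y #_s ν) ≤ (1−t)d(X,Y) + t·d₁^W(μ,ν) + |t−s|·d₁^W(δ_Y, ν). -/

import Mathlib

open MeasureTheory
open scoped ComplexOrder

abbrev Mat (m : ℕ) := Matrix (Fin m) (Fin m) ℂ

noncomputable instance {m : ℕ} : MeasurableSpace (Mat m) := borel _
instance {m : ℕ} : BorelSpace (Mat m) := ⟨rfl⟩

/-- Functional calculus on Hermitian matrices (junk value `A` otherwise). -/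
noncomputable def matFun {m : ℕ} (f : ℝ → ℝ) (A : Mat m) : Mat m :=
  if h : A.IsHermitian then
    (h.eigenvectorUnitary : Mat m) *
      Matrix.diagonal (fun i => (f (h.eigenvalues i) : ℂ)) *
      star (h.eigenvectorUnitary : Mat m)
  else A

/-- Real power `A^t` of a positive definite matrix, via the spectral decomposition. -/
noncomputable def mpow {m : ℕ} (A : Mat m) (t : ℝ) : Mat m := matFun (fun x => x ^ t) A

/-- Logarithm of a positive definite matrix, via the spectral decomposition. -/
noncomputable def mlog {m : ℕ} (A : Mat m) : Mat m := matFun Real.log A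

/-- The operator norm of a matrix (acting on the Euclidean space). -/
noncomputable def opN {m : ℕ} (A : Mat m) : ℝ :=
  ‖(Matrix.toEuclideanCLM (𝕜 := ℂ) A : EuclideanSpace ℂ (Fin m) →L[ℂ] EuclideanSpace ℂ (Fin m))‖

/-- The Frobenius (Hilbert-Schmidt) norm of a matrix. -/
noncomputable def fnorm {m : ℕ} (A : Mat m) : ℝ :=
  Real.sqrt (∑ i, ∑ j, ‖A i j‖ ^ 2)

/-- The Riemannian trace metric distance `d(A,B) = ‖log (A^{-1/2} B A^{-1/2})‖₂`. -/
noncomputable def rdist {m : ℕ} (A B : Mat m) : ℝ :=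
  fnorm (mlog (mpow A (-(1/2 : ℝ)) * B * mpow A (-(1/2 : ℝ))))

/-- The `t`-weighted geometric mean `X #_t A = X^{1/2} (X^{-1/2} A X^{-1/2})^t X^{1/2}`. -/
noncomputable def geom {m : ℕ} (X : Mat m) (t : ℝ) (A : Mat m) : Mat m :=
  mpow X (1/2 : ℝ) * mpow (mpow X (-(1/2 : ℝ)) * A * mpow X (-(1/2 : ℝ))) t * mpow X (1/2 : ℝ)

/-- Finite first moment for a measure on positive definite matrices. -/
def HasFFM {m : ℕ} (μ : Measure (Mat m)) : Prop :=
  ∃ Y : Mat m, Y.PosDef ∧ Integrable (fun A => rdist A Y) μ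

/-- Couplings of two probability measures. -/
def couplings {m : ℕ} (μ ν : Measure (Mat m)) : Set (Measure (Mat m × Mat m)) :=
  {π | IsProbabilityMeasure π ∧ π.map Prod.fst = μ ∧ π.map Prod.snd = ν}

/-- The 1-Wasserstein distance with respect to the Riemannian trace metric. -/
noncomputable def W1 {m : ℕ} (μ ν : Measure (Mat m)) : ℝ :=
  sInf ((fun π : Measure (Mat m × Mat m) => ∫ p, rdist p.1 p.2 ∂π) '' couplings μ ν)

section MatrixFunctions

variable {m : ℕ} {A B X : Mat m} {f g : ℝ → ℝ}

lemma matFun_eq_cfc (hA : A.IsHermitian) (f : ℝ → ℝ) : matFun f A = cfc f A := by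
  rw [hA.cfc_eq, matFun, dif_pos hA, Matrix.IsHermitian.cfc, Unitary.conjStarAlgAut_apply]
  rfl

lemma isHermitian_matFun (hA : A.IsHermitian) (f : ℝ → ℝ) : (matFun f A).IsHermitian := by
  rw [matFun_eq_cfc hA]
  exact cfc_predicate f A

lemma continuousOn_spectrum (f : ℝ → ℝ) (A : Mat m) : ContinuousOn f (spectrum ℝ A) :=
  (Matrix.finite_real_spectrum (A := A)).continuousOn f

lemma Matrix.PosDef.spectrum_pos (hA : A.PosDef) {x : ℝ} (hx : x ∈ spectrum ℝ A) : 0 < x := by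
  rw [hA.isHermitian.spectrum_real_eq_range_eigenvalues] at hx
  obtain ⟨i, rfl⟩ := hx
  exact hA.eigenvalues_pos i

lemma matFun_congr (hA : A.PosDef) (h : ∀ x, 0 < x → f x = g x) : matFun f A = matFun g A := by
  rw [matFun_eq_cfc hA.isHermitian, matFun_eq_cfc hA.isHermitian]
  exact cfc_congr fun x hx => h x (hA.spectrum_pos hx)

lemma matFun_id (hA : A.IsHermitian) : matFun (fun x => x) A = A := by
  rw [matFun_eq_cfc hA]
  exact cfc_id' ℝ A hA

lemma matFun_one (hA : A.IsHermitian) : matFun (fun _ => 1) A = 1 := by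
  rw [matFun_eq_cfc hA]
  exact cfc_one ℝ A hA

lemma matFun_mul (hA : A.IsHermitian) (f g : ℝ → ℝ) :
    matFun (fun x => f x * g x) A = matFun f A * matFun g A := by
  simp only [matFun_eq_cfc hA]
  exact cfc_mul f g A (continuousOn_spectrum _ _) (continuousOn_spectrum _ _)

lemma matFun_const_mul (hA : A.IsHermitian) (r : ℝ) (f : ℝ → ℝ) :
    matFun (fun x => r * f x) A = r • matFun f A := by
  simp only [matFun_eq_cfc hA]
  exact cfc_const_mul r f A (continuousOn_spectrum _ _)

lemma matFun_comp (hA : A.IsHermitian) (g f : ℝ → ℝ) :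
    matFun (fun x => g (f x)) A = matFun g (matFun f A) := by
  rw [matFun_eq_cfc (isHermitian_matFun hA f), matFun_eq_cfc hA, matFun_eq_cfc hA]
  exact cfc_comp' g f A
    (((Matrix.finite_real_spectrum (A := A)).image f).continuousOn g)
    (continuousOn_spectrum _ _) hA

lemma posDef_matFun (hA : A.PosDef) (hf : ∀ x, 0 < x → 0 < f x) : (matFun f A).PosDef := by
  have h := isHermitian_matFun hA.isHermitian f
  rw [h.posDef_iff_eigenvalues_pos]
  intro i
  have hi := h.eigenvalues_mem_spectrum_real i
  generalize h.eigenvalues i = x at hi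
  rw [matFun_eq_cfc hA.isHermitian] at hi
  obtain ⟨y, hy, rfl⟩ :=
    (cfc_map_spectrum f A hA.isHermitian (continuousOn_spectrum _ _)).subset hi
  exact hf y (hA.spectrum_pos hy)

/-- The functional calculus commutes with unitary conjugation. -/
lemma matFun_conj {U : Mat m} (hU : U * star U = 1) (hA : A.IsHermitian) (f : ℝ → ℝ) :
    matFun f (U * A * star U) = U * matFun f A * star U := by
  let u : unitary (Mat m) := ⟨U, Unitary.mem_iff.2 ⟨mul_eq_one_comm.1 hU, hU⟩⟩
  let φ : Mat m ≃⋆ₐ[ℝ] Mat m := Unitary.conjStarAlgAut ℝ (Mat m) u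
  have hφ : ∀ B, φ B = U * B * star U := fun B => Unitary.conjStarAlgAut_apply u B
  have hc : Continuous φ := by
    have : (φ : Mat m → Mat m) = fun B => U * B * star U := funext hφ
    rw [this]
    fun_prop
  have hA' : IsSelfAdjoint (φ A) := IsSelfAdjoint.map hA φ
  have := StarAlgHomClass.map_cfc (S := ℝ) φ f A (continuousOn_spectrum _ _) hc hA hA'
  rw [matFun_eq_cfc hA, ← hφ, ← hφ, this, matFun_eq_cfc]
  exact hA'

lemma posDef_mpow (hA : A.PosDef) (t : ℝ) : (mpow A t).PosDef :=
  posDef_matFun hA fun _ hx => Real.rpow_pos_of_pos hx t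

lemma mpow_add (hA : A.PosDef) (s t : ℝ) : mpow A s * mpow A t = mpow A (s + t) := by
  rw [mpow, mpow, ← matFun_mul hA.isHermitian]
  exact matFun_congr hA fun x hx => (Real.rpow_add hx s t).symm

lemma mpow_zero (hA : A.PosDef) : mpow A 0 = 1 := by
  rw [mpow, ← matFun_one hA.isHermitian]
  exact matFun_congr hA fun x _ => Real.rpow_zero x

lemma mpow_one (hA : A.PosDef) : mpow A 1 = A := by
  nth_rewrite 2 [← matFun_id hA.isHermitian]
  exact matFun_congr hA fun x _ => Real.rpow_one x

lemma mpow_mpow (hA : A.PosDef) (s t : ℝ) : mpow (mpow A s) t = mpow A (s * t) := by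
  rw [mpow, mpow, ← matFun_comp hA.isHermitian]
  exact matFun_congr hA fun x hx => (Real.rpow_mul hx.le s t).symm

lemma mlog_mpow (hA : A.PosDef) (t : ℝ) : mlog (mpow A t) = t • mlog A := by
  rw [mlog, mpow, ← matFun_comp hA.isHermitian, mlog, ← matFun_const_mul hA.isHermitian]
  exact matFun_congr hA fun x hx => Real.log_rpow hx t

lemma mpow_mul_mpow_neg (hA : A.PosDef) (t : ℝ) : mpow A t * mpow A (-t) = 1 := by
  rw [mpow_add hA, add_neg_cancel, mpow_zero hA]

lemma mpow_neg_mul_mpow (hA : A.PosDef) (t : ℝ) : mpow A (-t) * mpow A t = 1 := by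
  rw [mpow_add hA, neg_add_cancel, mpow_zero hA]

lemma inv_mpow (hA : A.PosDef) (t : ℝ) : (mpow A t)⁻¹ = mpow A (-t) :=
  Matrix.inv_eq_right_inv (mpow_mul_mpow_neg hA t)

lemma star_mpow (hA : A.PosDef) (t : ℝ) : star (mpow A t) = mpow A t :=
  (posDef_mpow hA t).isHermitian

lemma mpow_half_mul_self (hA : A.PosDef) : mpow A (1 / 2) * mpow A (1 / 2) = A := by
  rw [mpow_add hA, add_halves, mpow_one hA]

lemma mpow_one_left (t : ℝ) : mpow (1 : Mat m) t = 1 := by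
  have h : (1 : Mat m).PosDef := .one
  nth_rewrite 1 [← mpow_zero h]
  rw [mpow_mpow h, zero_mul, mpow_zero h]

lemma Matrix.PosDef.conj {G : Mat m} (hA : A.PosDef) (hG : IsUnit G) :
    (G * A * star G).PosDef :=
  hA.mul_mul_conjTranspose_same (Matrix.vecMul_injective_of_isUnit hG)

lemma posDef_mpow_conj (hA : A.PosDef) (hB : B.PosDef) (t : ℝ) :
    (mpow A t * B * mpow A t).PosDef := by
  have := hB.conj (posDef_mpow hA t).isUnit
  rwa [star_mpow hA] at this

lemma posDef_geom (hX : X.PosDef) (hA : A.PosDef) (t : ℝ) : (geom X t A).PosDef :=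
  posDef_mpow_conj hX (posDef_mpow (posDef_mpow_conj hX hA _) t) _

end MatrixFunctions

section TraceFormulas

variable {m : ℕ} {A C : Mat m}

/-- Traces of products of functions of two Hermitian matrices, through the overlaps of their
eigenbases. -/
lemma exists_trace_matFun_mul_matFun (hA : A.PosDef) (hC : C.PosDef) :
    ∃ (w : Fin m → Fin m → ℝ) (a c : Fin m → ℝ), (∀ i j, 0 ≤ w i j) ∧ (∀ i, 0 < a i) ∧
      (∀ j, 0 < c j) ∧ ∀ f g : ℝ → ℝ, (matFun f A * matFun g C).trace.re =
        ∑ i, ∑ j, w i j * (f (a i) * g (c j)) := by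
  have hA' := hA.isHermitian
  have hC' := hC.isHermitian
  set U : Mat m := (hA'.eigenvectorUnitary : Mat m) with hU
  set V : Mat m := (hC'.eigenvectorUnitary : Mat m) with hV
  refine ⟨fun i j => Complex.normSq ((star U * V) i j), hA'.eigenvalues, hC'.eigenvalues,
    fun i j => Complex.normSq_nonneg _, hA.eigenvalues_pos, hC.eigenvalues_pos, fun f g => ?_⟩
  rw [matFun, dif_pos hA', matFun, dif_pos hC', ← hU, ← hV]
  have : (U * Matrix.diagonal (fun i => (f (hA'.eigenvalues i) : ℂ)) * star U *
      (V * Matrix.diagonal (fun i => (g (hC'.eigenvalues i) : ℂ)) * star V)).trace =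
      (Matrix.diagonal (fun i => (f (hA'.eigenvalues i) : ℂ)) * (star U * V) *
        (Matrix.diagonal (fun i => (g (hC'.eigenvalues i) : ℂ)) * star (star U * V))).trace := by
    rw [star_mul, star_star, mul_assoc, mul_assoc, Matrix.trace_mul_comm]
    simp only [mul_assoc]
  rw [this]
  generalize star U * V = W
  simp only [Matrix.trace, Matrix.diag_apply, Complex.re_sum]
  refine Finset.sum_congr rfl fun i _ => ?_
  rw [Matrix.mul_apply, Complex.re_sum]
  refine Finset.sum_congr rfl fun j _ => ?_
  rw [Matrix.diagonal_mul, Matrix.diagonal_mul, Matrix.star_apply]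
  simp [Complex.normSq_apply]
  ring

lemma exists_trace_matFun (hA : A.PosDef) :
    ∃ (w a : Fin m → ℝ), (∀ i, 0 ≤ w i) ∧ (∀ i, 0 < a i) ∧
      ∀ f : ℝ → ℝ, (matFun f A).trace.re = ∑ i, w i * f (a i) := by
  obtain ⟨w, a, c, hw, ha, hc, h⟩ := exists_trace_matFun_mul_matFun hA hA
  refine ⟨fun i => ∑ j, w i j, a, fun i => Finset.sum_nonneg fun j _ => hw i j, ha, fun f => ?_⟩
  have := h f (fun _ => 1)
  rw [matFun_one hA.isHermitian, mul_one] at this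
  simpa [Finset.sum_mul] using this

lemma fnorm_nonneg (A : Mat m) : 0 ≤ fnorm A := Real.sqrt_nonneg _

lemma fnorm_sq_eq_sum (A : Mat m) : fnorm A ^ 2 = ∑ i, ∑ j, ‖A i j‖ ^ 2 :=
  Real.sq_sqrt (by positivity)

lemma fnorm_sq (hA : A.IsHermitian) : fnorm A ^ 2 = (A * A).trace.re := by
  rw [fnorm_sq_eq_sum]
  nth_rewrite 3 [← hA.eq]
  simp only [Matrix.trace, Matrix.diag_apply, Complex.re_sum, Matrix.mul_apply,
    Matrix.conjTranspose_apply]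
  refine Finset.sum_congr rfl fun i _ => Finset.sum_congr rfl fun j _ => ?_
  rw [← Complex.normSq_eq_norm_sq, Complex.normSq_apply]
  simp

section

attribute [local instance] Matrix.frobeniusNormedAddCommGroup Matrix.frobeniusNormedSpace

lemma fnorm_eq_norm (A : Mat m) : fnorm A = ‖A‖ := by
  rw [Matrix.frobenius_norm_def, fnorm, Real.sqrt_eq_rpow]
  simp

lemma fnorm_add_le (A B : Mat m) : fnorm (A + B) ≤ fnorm A + fnorm B := by
  simpa only [fnorm_eq_norm] using norm_add_le A B

lemma fnorm_smul (r : ℝ) (A : Mat m) : fnorm (r • A) = |r| * fnorm A := by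
  simpa only [fnorm_eq_norm, Real.norm_eq_abs] using norm_smul r A

end

lemma fnorm_mlog_sq (hA : A.PosDef) :
    fnorm (mlog A) ^ 2 = (matFun (fun x => Real.log x ^ 2) A).trace.re := by
  rw [mlog, fnorm_sq (isHermitian_matFun hA.isHermitian _), ← matFun_mul hA.isHermitian]
  simp only [sq]

end TraceFormulas

section ScalarBounds

lemma exp_add_exp_neg_sub_two (x : ℝ) :
    Real.exp x + Real.exp (-x) - 2 = (2 * Real.sinh (x / 2)) ^ 2 := by
  have h : Real.exp x = Real.exp (x / 2) ^ 2 := by rw [← Real.exp_nat_mul]; congr 1; push_cast; ring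
  have h' : Real.exp (-x) = Real.exp (-(x / 2)) ^ 2 := by
    rw [← Real.exp_nat_mul]; congr 1; push_cast; ring
  have h1 : Real.exp (x / 2) * Real.exp (-(x / 2)) = 1 := by
    rw [← Real.exp_add, add_neg_cancel, Real.exp_zero]
  rw [Real.sinh_eq, h, h']
  linear_combination 2 * h1

lemma sq_le_exp_add_exp_neg_sub_two (x : ℝ) : x ^ 2 ≤ Real.exp x + Real.exp (-x) - 2 := by
  rw [exp_add_exp_neg_sub_two, sq_le_sq, abs_mul, Real.abs_sinh]
  have := Real.self_le_sinh_iff.2 (abs_nonneg (x / 2))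
  have h2 : |x / 2| = |x| / 2 := by rw [abs_div, abs_two]
  rw [abs_two]
  linarith

lemma sinh_mul_le {t x : ℝ} (ht : t ∈ Set.Icc (0 : ℝ) 1) (hx : 0 ≤ x) :
    Real.sinh (t * x) ≤ t * Real.sinh x := by
  have hconv : ConvexOn ℝ (Set.Ici (0 : ℝ)) Real.sinh := by
    refine convexOn_of_deriv2_nonneg (convex_Ici 0) Real.continuous_sinh.continuousOn
      Real.differentiable_sinh.differentiableOn ?_ ?_
    · rw [Real.deriv_sinh]
      exact Real.differentiable_cosh.differentiableOn
    · intro y hy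
      rw [interior_Ici] at hy
      simpa using (Real.sinh_pos_iff.2 hy).le
  have := hconv.2 (Set.mem_Ici.2 hx) (Set.mem_Ici.2 le_rfl) ht.1 (sub_nonneg.2 ht.2)
    (add_sub_cancel t 1)
  simpa using this

lemma exp_mul_add_exp_neg_mul_sub_two_le {t : ℝ} (ht : t ∈ Set.Icc (0 : ℝ) 1) (x : ℝ) :
    Real.exp (t * x) + Real.exp (-(t * x)) - 2 ≤ t ^ 2 * (Real.exp x + Real.exp (-x) - 2) := by
  rw [exp_add_exp_neg_sub_two, exp_add_exp_neg_sub_two, ← mul_pow, sq_le_sq]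
  simp only [abs_mul, Real.abs_sinh, abs_two, abs_of_nonneg ht.1]
  have := sinh_mul_le ht (abs_nonneg (x / 2))
  rw [mul_div_assoc, abs_mul, abs_of_nonneg ht.1]
  linarith

lemma tendsto_sq_mul_exp_add_exp_neg_sub_two (x : ℝ) :
    Filter.Tendsto (fun n : ℕ => ((n : ℝ) + 1) ^ 2 *
      (Real.exp (x / (n + 1)) + Real.exp (-(x / (n + 1))) - 2)) Filter.atTop (nhds (x ^ 2)) := by
  have hd : HasDerivAt (fun h : ℝ => 2 * Real.sinh (h * x / 2)) x 0 := by
    have h1 : HasDerivAt (fun h : ℝ => h * x / 2) (x / 2) 0 := by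
      simpa using ((hasDerivAt_id (0 : ℝ)).mul_const x).div_const 2
    have h2 := (h1.sinh).const_mul 2
    rwa [zero_mul, zero_div, Real.cosh_zero, one_mul, mul_div_cancel₀ x two_ne_zero] at h2
  have hlim : Filter.Tendsto (fun n : ℕ => (1 : ℝ) / ((n : ℝ) + 1)) Filter.atTop
      (nhdsWithin 0 {0}ᶜ) :=
    tendsto_nhdsWithin_iff.2 ⟨tendsto_one_div_add_atTop_nhds_zero_nat,
      Filter.Eventually.of_forall fun n => by
        have : (0 : ℝ) < 1 / ((n : ℝ) + 1) := by positivity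
        exact this.ne'⟩
  have h3 := ((hasDerivAt_iff_tendsto_slope.1 hd).comp hlim).pow 2
  refine h3.congr fun n => ?_
  rw [exp_add_exp_neg_sub_two]
  have hn : ((n : ℝ) + 1) ≠ 0 := by positivity
  simp only [Function.comp_apply, slope_def_field]
  rw [zero_mul, zero_div, Real.sinh_zero, mul_zero, sub_zero, sub_zero, ← mul_pow]
  congr 1
  field_simp

end ScalarBounds

section RelativePosition

variable {m : ℕ} {A B G : Mat m}

/-- The matrix `A^{-1/2} B A^{-1/2}` describing the position of `B` relative to `A`. -/
noncomputable def relPos (A B : Mat m) : Mat m :=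
  mpow A (-(1 / 2)) * B * mpow A (-(1 / 2))

lemma rdist_eq_relPos (A B : Mat m) : rdist A B = fnorm (mlog (relPos A B)) := rfl

lemma geom_eq_relPos (A B : Mat m) (t : ℝ) :
    geom A t B = mpow A (1 / 2) * mpow (relPos A B) t * mpow A (1 / 2) := rfl

lemma posDef_relPos (hA : A.PosDef) (hB : B.PosDef) : (relPos A B).PosDef :=
  posDef_mpow_conj hA hB _

lemma half_mul_relPos_mul_half (hA : A.PosDef) (B : Mat m) :
    mpow A (1 / 2) * relPos A B * mpow A (1 / 2) = B := by
  have h1 := mpow_mul_mpow_neg hA (1 / 2)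
  have h2 := mpow_neg_mul_mpow hA (1 / 2)
  calc _ = (mpow A (1 / 2) * mpow A (-(1 / 2))) * B * (mpow A (-(1 / 2)) * mpow A (1 / 2)) := by
        simp only [relPos, mul_assoc]
    _ = B := by rw [h1, h2, one_mul, mul_one]

/-- The unitary matrix relating relative positions before and after a congruence by `G`. -/
lemma exists_unitary_relPos (hA : A.PosDef) (hG : IsUnit G) :
    ∃ U : Mat m, U * star U = 1 ∧
      mpow (G * A * star G) (1 / 2) * U = G * mpow A (1 / 2) ∧
      ∀ B, relPos (G * A * star G) (G * B * star G) = U * relPos A B * star U := by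
  have hGA := hA.conj hG
  have h1 := mpow_mul_mpow_neg hA (1 / 2)
  have h2 := mpow_neg_mul_mpow hA (1 / 2)
  have h3 := mpow_mul_mpow_neg hGA (1 / 2)
  have h4 := mpow_neg_mul_mpow hGA (1 / 2)
  have h5 := mpow_half_mul_self hA
  have h6 := mpow_half_mul_self hGA
  have hs : star (mpow (G * A * star G) (-(1 / 2)) * G * mpow A (1 / 2)) =
      mpow A (1 / 2) * star G * mpow (G * A * star G) (-(1 / 2)) := by
    rw [star_mul, star_mul, star_mpow hA, star_mpow hGA, ← mul_assoc]
  refine ⟨mpow (G * A * star G) (-(1 / 2)) * G * mpow A (1 / 2), ?_, ?_, fun B => ?_⟩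
  · rw [hs]
    calc _ = mpow (G * A * star G) (-(1 / 2)) *
          (G * (mpow A (1 / 2) * mpow A (1 / 2)) * star G) *
          mpow (G * A * star G) (-(1 / 2)) := by simp only [mul_assoc]
      _ = mpow (G * A * star G) (-(1 / 2)) *
          (mpow (G * A * star G) (1 / 2) * mpow (G * A * star G) (1 / 2)) *
          mpow (G * A * star G) (-(1 / 2)) := by rw [h5, h6]
      _ = (mpow (G * A * star G) (-(1 / 2)) * mpow (G * A * star G) (1 / 2)) *
          (mpow (G * A * star G) (1 / 2) * mpow (G * A * star G) (-(1 / 2))) := by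
            simp only [mul_assoc]
      _ = 1 := by rw [h3, h4, one_mul]
  · rw [← mul_assoc, ← mul_assoc, h3, one_mul]
  · rw [hs]
    calc _ = mpow (G * A * star G) (-(1 / 2)) * G * 1 * B * 1 * star G *
          mpow (G * A * star G) (-(1 / 2)) := by simp only [relPos, mul_assoc, mul_one]
      _ = mpow (G * A * star G) (-(1 / 2)) * G * (mpow A (1 / 2) * mpow A (-(1 / 2))) * B *
          (mpow A (-(1 / 2)) * mpow A (1 / 2)) * star G *
          mpow (G * A * star G) (-(1 / 2)) := by rw [h1, h2]
      _ = _ := by simp only [relPos, mul_assoc]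

lemma fnorm_unitary_conj {U : Mat m} (hU : U * star U = 1) (hA : A.IsHermitian) :
    fnorm (U * A * star U) = fnorm A := by
  have hU' : star U * U = 1 := mul_eq_one_comm.1 hU
  have hH : (U * A * star U).IsHermitian := Matrix.isHermitian_mul_mul_conjTranspose U hA
  rw [← sq_eq_sq₀ (fnorm_nonneg _) (fnorm_nonneg _), fnorm_sq hH, fnorm_sq hA]
  have : U * A * star U * (U * A * star U) = U * (A * A * star U) := by
    calc _ = U * A * (star U * U) * (A * star U) := by simp only [mul_assoc]
      _ = _ := by rw [hU', mul_one]; simp only [mul_assoc]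
  rw [this, Matrix.trace_mul_comm, mul_assoc, hU', mul_one]

/-- The trace metric is invariant under congruence. -/
lemma rdist_congruence (hA : A.PosDef) (hB : B.PosDef) (hG : IsUnit G) :
    rdist (G * A * star G) (G * B * star G) = rdist A B := by
  obtain ⟨U, hU, -, h⟩ := exists_unitary_relPos hA hG
  have hR := (posDef_relPos hA hB).isHermitian
  rw [rdist_eq_relPos, h, mlog, matFun_conj hU hR,
    fnorm_unitary_conj hU (isHermitian_matFun hR _)]
  rfl

/-- Weighted geometric means are equivariant under congruence. -/
lemma geom_congruence (hA : A.PosDef) (hB : B.PosDef) (hG : IsUnit G) (t : ℝ) :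
    geom (G * A * star G) t (G * B * star G) = G * geom A t B * star G := by
  obtain ⟨U, hU, hUA, h⟩ := exists_unitary_relPos hA hG
  have hR := (posDef_relPos hA hB).isHermitian
  have hUA' : star U * mpow (G * A * star G) (1 / 2) = mpow A (1 / 2) * star G := by
    have := congrArg star hUA
    rwa [star_mul, star_mul, star_mpow hA, star_mpow (hA.conj hG)] at this
  rw [geom_eq_relPos, h, mpow, mpow, matFun_conj hU hR, ← mpow]
  calc _ = (mpow (G * A * star G) (1 / 2) * U) * mpow (relPos A B) t *
        (star U * mpow (G * A * star G) (1 / 2)) := by simp only [mpow, mul_assoc]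
    _ = _ := by rw [hUA, hUA', geom_eq_relPos]; simp only [mul_assoc]

lemma relPos_one (B : Mat m) : relPos 1 B = B := by
  simp only [relPos, mpow_one_left, one_mul, mul_one]

lemma rdist_one (B : Mat m) : rdist 1 B = fnorm (mlog B) := by
  rw [rdist_eq_relPos, relPos_one]

lemma geom_one (B : Mat m) (t : ℝ) : geom 1 t B = mpow B t := by
  rw [geom_eq_relPos, relPos_one, mpow_one_left, one_mul, mul_one]

/-- Every pair of positive definite matrices is congruent to a pair `(1, M)`. -/
lemma exists_congruence_one (hA : A.PosDef) (hB : B.PosDef) :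
    ∃ G M : Mat m, IsUnit G ∧ M.PosDef ∧ G * 1 * star G = A ∧ G * M * star G = B := by
  refine ⟨mpow A (1 / 2), relPos A B, (posDef_mpow hA _).isUnit, posDef_relPos hA hB, ?_, ?_⟩
  · rw [star_mpow hA, mul_one, mpow_half_mul_self hA]
  · rw [star_mpow hA, half_mul_relPos_mul_half hA]

lemma relPos_mpow_mpow (hA : A.PosDef) (s t : ℝ) :
    relPos (mpow A s) (mpow A t) = mpow A (t - s) := by
  rw [relPos, mpow_mpow hA, mpow_add hA, mpow_add hA]
  congr 1
  ring

lemma rdist_mpow_mpow (hA : A.PosDef) (s t : ℝ) :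
    rdist (mpow A s) (mpow A t) = |t - s| * fnorm (mlog A) := by
  rw [rdist_eq_relPos, relPos_mpow_mpow hA, mlog_mpow hA, fnorm_smul]

lemma rdist_comm (hA : A.PosDef) (hB : B.PosDef) : rdist A B = rdist B A := by
  obtain ⟨G, M, hG, hM, rfl, rfl⟩ := exists_congruence_one hA hB
  rw [rdist_congruence .one hM hG, rdist_congruence hM .one hG, ← mpow_one hM, ← mpow_zero hM,
    rdist_mpow_mpow hM, rdist_mpow_mpow hM, abs_sub_comm]

lemma geom_comm (hA : A.PosDef) (hB : B.PosDef) (t : ℝ) : geom A t B = geom B (1 - t) A := by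
  obtain ⟨G, M, hG, hM, rfl, rfl⟩ := exists_congruence_one hA hB
  rw [geom_congruence .one hM hG, geom_congruence hM .one hG]
  have h1 : geom M (1 - t) 1 = mpow M t := by
    have := relPos_mpow_mpow hM 1 0
    rw [mpow_one hM, mpow_zero hM] at this
    rw [geom_eq_relPos, this, mpow_mpow hM, mpow_add hM, mpow_add hM]
    congr 1
    ring
  rw [h1, geom_one]

lemma rdist_geom_geom (hA : A.PosDef) (hB : B.PosDef) (s t : ℝ) :
    rdist (geom A s B) (geom A t B) = |t - s| * rdist A B := by
  obtain ⟨G, M, hG, hM, rfl, rfl⟩ := exists_congruence_one hA hB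
  rw [geom_congruence .one hM hG, geom_congruence .one hM hG, rdist_congruence .one hM hG,
    geom_one, geom_one, rdist_congruence (posDef_mpow hM s) (posDef_mpow hM t) hG,
    rdist_mpow_mpow hM, rdist_one]

end RelativePosition

section NonpositiveCurvature

variable {m : ℕ} {A B C G X Y : Mat m} {t : ℝ}

/-- The quantity `tr (A⁻¹ B) + tr (B⁻¹ A) - 2 tr 1`, which agrees with the square of the trace
metric to second order near the diagonal. -/
noncomputable def traceDiv (A B : Mat m) : ℝ :=
  (A⁻¹ * B).trace.re + (B⁻¹ * A).trace.re - 2 * (1 : Mat m).trace.re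

lemma traceDiv_self (hA : A.PosDef) : traceDiv A A = 0 := by
  have : A⁻¹ * A = 1 :=
    Matrix.nonsing_inv_mul A ((Matrix.isUnit_iff_isUnit_det A).1 hA.isUnit)
  rw [traceDiv, this]
  ring

lemma traceDiv_congruence (hG : IsUnit G) (A B : Mat m) :
    traceDiv (G * A * star G) (G * B * star G) = traceDiv A B := by
  have hG' := (Matrix.isUnit_iff_isUnit_det G).1 hG
  have hs := (Matrix.isUnit_iff_isUnit_det (star G)).1 hG.star
  have key : ∀ A B : Mat m, ((G * A * star G)⁻¹ * (G * B * star G)).trace = (A⁻¹ * B).trace := by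
    intro A B
    have : (G * A * star G)⁻¹ * (G * B * star G) = (star G)⁻¹ * (A⁻¹ * B * star G) := by
      calc _ = (star G)⁻¹ * A⁻¹ * (G⁻¹ * G) * (B * star G) := by
            simp only [Matrix.mul_inv_rev, mul_assoc]
        _ = _ := by rw [Matrix.nonsing_inv_mul G hG', mul_one]; simp only [mul_assoc]
    rw [this, Matrix.trace_mul_comm, mul_assoc, Matrix.mul_nonsing_inv _ hs, mul_one]
  rw [traceDiv, traceDiv, key, key]

/-- In terms of the two spectra, passing to logarithms or to powers acts on each pair of
eigenvalues separately. -/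
lemma exists_spectral_pair (hA : A.PosDef) (hB : B.PosDef) :
    ∃ w x : Fin m → Fin m → ℝ, (∀ i j, 0 ≤ w i j) ∧
      fnorm (mlog A - mlog B) ^ 2 = ∑ i, ∑ j, w i j * x i j ^ 2 ∧
      ∀ t, traceDiv (mpow A t) (mpow B t) =
        ∑ i, ∑ j, w i j * (Real.exp (t * x i j) + Real.exp (-(t * x i j)) - 2) := by
  obtain ⟨w, a, b, hw, ha, hb, h⟩ := exists_trace_matFun_mul_matFun hA hB
  have hA1 := matFun_one hA.isHermitian
  have hB1 := matFun_one hB.isHermitian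
  refine ⟨w, fun i j => Real.log (b j) - Real.log (a i), hw, ?_, fun t => ?_⟩
  · have hAB := (isHermitian_matFun hA.isHermitian Real.log).sub
      (isHermitian_matFun hB.isHermitian Real.log)
    have e1 := h (fun x => Real.log x * Real.log x) (fun _ => 1)
    have e2 := h (fun _ => 1) (fun x => Real.log x * Real.log x)
    have e3 := h Real.log Real.log
    rw [hB1, mul_one, matFun_mul hA.isHermitian] at e1
    rw [hA1, one_mul, matFun_mul hB.isHermitian] at e2
    rw [mlog, mlog, fnorm_sq hAB, sub_mul, mul_sub, mul_sub]
    simp only [Matrix.trace_sub, Complex.sub_re]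
    rw [Matrix.trace_mul_comm (matFun Real.log B) (matFun Real.log A), e1, e2, e3]
    simp only [← Finset.sum_sub_distrib]
    exact Finset.sum_congr rfl fun i _ => Finset.sum_congr rfl fun j _ => by ring
  · have e1 := h (fun x => x ^ (-t)) (fun x => x ^ t)
    have e2 := h (fun x => x ^ t) (fun x => x ^ (-t))
    have e3 := h (fun _ => 1) (fun _ => 1)
    rw [hA1, hB1, mul_one] at e3
    rw [traceDiv, inv_mpow hA, inv_mpow hB, Matrix.trace_mul_comm (mpow B (-t))]
    simp only [mpow]
    rw [e1, e2, e3, Finset.mul_sum]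
    simp only [Finset.mul_sum, ← Finset.sum_sub_distrib, ← Finset.sum_add_distrib]
    refine Finset.sum_congr rfl fun i _ => Finset.sum_congr rfl fun j _ => ?_
    simp only [Real.rpow_def_of_pos (ha i), Real.rpow_def_of_pos (hb j), ← Real.exp_add]
    ring_nf

/-- Spectral expression of the trace metric, and of `traceDiv` along the geodesic. -/
lemma exists_spectral_rdist (hA : A.PosDef) :
    ∃ w x : Fin m → ℝ, (∀ i, 0 ≤ w i) ∧ rdist 1 A ^ 2 = ∑ i, w i * x i ^ 2 ∧
      ∀ s t, traceDiv (mpow A s) (mpow A t) =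
        ∑ i, w i * (Real.exp ((t - s) * x i) + Real.exp (-((t - s) * x i)) - 2) := by
  obtain ⟨w, a, hw, ha, h⟩ := exists_trace_matFun hA
  refine ⟨w, fun i => Real.log (a i), hw, ?_, fun s t => ?_⟩
  · rw [rdist_one, fnorm_mlog_sq hA, h]
  · have e1 := h (fun x => x ^ (t - s))
    have e2 := h (fun x => x ^ (s - t))
    have e3 := h (fun _ => 1)
    rw [matFun_one hA.isHermitian] at e3
    rw [traceDiv, inv_mpow hA, inv_mpow hA, mpow_add hA, mpow_add hA, neg_add_eq_sub,
      neg_add_eq_sub, mpow, mpow, e1, e2, e3, Finset.mul_sum]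
    simp only [← Finset.sum_sub_distrib, ← Finset.sum_add_distrib]
    refine Finset.sum_congr rfl fun i _ => ?_
    simp only [Real.rpow_def_of_pos (ha i)]
    ring_nf

lemma fnorm_mlog_sub_mlog_sq_le (hA : A.PosDef) (hB : B.PosDef) :
    fnorm (mlog A - mlog B) ^ 2 ≤ traceDiv A B := by
  obtain ⟨w, x, hw, h1, h2⟩ := exists_spectral_pair hA hB
  have h3 := h2 1
  rw [mpow_one hA, mpow_one hB] at h3
  rw [h1, h3]
  refine Finset.sum_le_sum fun i _ => Finset.sum_le_sum fun j _ => ?_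
  rw [one_mul]
  exact mul_le_mul_of_nonneg_left (sq_le_exp_add_exp_neg_sub_two _) (hw i j)

lemma traceDiv_mpow_le (hA : A.PosDef) (hB : B.PosDef) (ht : t ∈ Set.Icc (0 : ℝ) 1) :
    traceDiv (mpow A t) (mpow B t) ≤ t ^ 2 * traceDiv A B := by
  obtain ⟨w, x, hw, -, h2⟩ := exists_spectral_pair hA hB
  have h3 := h2 1
  rw [mpow_one hA, mpow_one hB] at h3
  rw [h2, h3, Finset.mul_sum]
  simp only [Finset.mul_sum]
  refine Finset.sum_le_sum fun i _ => Finset.sum_le_sum fun j _ => ?_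
  rw [one_mul, mul_left_comm]
  exact mul_le_mul_of_nonneg_left (exp_mul_add_exp_neg_mul_sub_two_le ht _) (hw i j)

lemma rdist_nonneg (A B : Mat m) : 0 ≤ rdist A B := fnorm_nonneg _

lemma rdist_sq_le_traceDiv (hA : A.PosDef) (hB : B.PosDef) : rdist A B ^ 2 ≤ traceDiv A B := by
  obtain ⟨G, M, hG, hM, rfl, rfl⟩ := exists_congruence_one hA hB
  obtain ⟨w, x, hw, h1, h2⟩ := exists_spectral_rdist hM
  have h3 := h2 0 1
  rw [mpow_zero hM, mpow_one hM] at h3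
  rw [rdist_congruence .one hM hG, traceDiv_congruence hG, h1, h3]
  refine Finset.sum_le_sum fun i _ => ?_
  rw [sub_zero, one_mul]
  exact mul_le_mul_of_nonneg_left (sq_le_exp_add_exp_neg_sub_two _) (hw i)

/-- A function satisfying the triangle inequality and infinitesimally dominated by the trace metric
is globally dominated by it: subdivide the geodesic. -/
lemma le_mul_rdist_of_sq_le {ρ : Mat m → Mat m → ℝ} {K : ℝ} (hK : 0 ≤ K)
    (hρ : ∀ A B C : Mat m, A.PosDef → B.PosDef → C.PosDef → ρ A C ≤ ρ A B + ρ B C)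
    (hloc : ∀ A B : Mat m, A.PosDef → B.PosDef → ρ A B ^ 2 ≤ K ^ 2 * traceDiv A B)
    (hA : A.PosDef) (hB : B.PosDef) : ρ A B ≤ K * rdist A B := by
  have hloc' : ∀ A B : Mat m, A.PosDef → B.PosDef → ρ A B ≤ K * √(traceDiv A B) := by
    intro A B hA hB
    refine (Real.le_sqrt_of_sq_le (hloc A B hA hB)).trans_eq ?_
    rw [Real.sqrt_mul (sq_nonneg K), Real.sqrt_sq hK]
  obtain ⟨G, M, hG, hM, rfl, rfl⟩ := exists_congruence_one hA hB
  obtain ⟨w, x, hw, h1, h2⟩ := exists_spectral_rdist hM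
  rw [rdist_congruence .one hM hG]
  set q : ℕ → ℝ := fun n =>
    ∑ i, w i * (Real.exp (x i / (n + 1)) + Real.exp (-(x i / (n + 1))) - 2) with hq
  have hstep : ∀ n j : ℕ, ρ (G * 1 * star G) (G * mpow M (j / (n + 1 : ℝ)) * star G) ≤
      j * (K * √(q n)) := by
    intro n j
    induction j with
    | zero =>
      have := hloc' _ _ hA hA
      rw [traceDiv_self hA, Real.sqrt_zero, mul_zero] at this
      simpa [mpow_zero hM] using this
    | succ j ih =>
      have hj := (posDef_mpow hM (j / (n + 1 : ℝ))).conj hG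
      have hj1 := (posDef_mpow hM ((j + 1 : ℕ) / (n + 1 : ℝ))).conj hG
      refine (hρ _ _ _ hA hj hj1).trans ?_
      have h3 := hloc' _ _ hj hj1
      have h4 : ((j + 1 : ℕ) / (n + 1 : ℝ) - j / (n + 1 : ℝ)) = 1 / (n + 1) := by
        push_cast
        ring
      rw [traceDiv_congruence hG, h2, h4] at h3
      simp only [one_div_mul_eq_div] at h3
      push_cast at h3 ih ⊢
      linarith
  have hle : ∀ n : ℕ, ρ (G * 1 * star G) (G * M * star G) ≤ K * √(((n : ℝ) + 1) ^ 2 * q n) := by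
    intro n
    have hn : (0 : ℝ) < n + 1 := by positivity
    have := hstep n (n + 1)
    push_cast at this
    rw [div_self hn.ne', mpow_one hM] at this
    rw [Real.sqrt_mul (sq_nonneg _), Real.sqrt_sq hn.le]
    linarith
  have hlim : Filter.Tendsto (fun n : ℕ => K * √(((n : ℝ) + 1) ^ 2 * q n)) Filter.atTop
      (nhds (K * rdist 1 M)) := by
    rw [← Real.sqrt_sq (rdist_nonneg 1 M), h1]
    refine (Filter.Tendsto.sqrt ?_).const_mul K
    simp only [hq, Finset.mul_sum]
    refine tendsto_finsetSum _ fun i _ => ?_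
    simp only [mul_left_comm _ (w i)]
    exact (tendsto_sq_mul_exp_add_exp_neg_sub_two (x i)).const_mul (w i)
  exact ge_of_tendsto' hlim hle

/-- The exponential metric increasing property. -/
lemma fnorm_mlog_sub_mlog_le_rdist (hA : A.PosDef) (hB : B.PosDef) :
    fnorm (mlog A - mlog B) ≤ rdist A B := by
  have := le_mul_rdist_of_sq_le (ρ := fun A B : Mat m => fnorm (mlog A - mlog B)) zero_le_one
    (fun A B C _ _ _ => by
      have := fnorm_add_le (mlog A - mlog B) (mlog B - mlog C)
      rwa [sub_add_sub_cancel] at this)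
    (fun A B hA hB => by
      rw [one_pow, one_mul]
      exact fnorm_mlog_sub_mlog_sq_le hA hB) hA hB
  rwa [one_mul] at this

lemma rdist_triangle (hA : A.PosDef) (hB : B.PosDef) (hC : C.PosDef) :
    rdist A C ≤ rdist A B + rdist B C := by
  have key : ∀ M N : Mat m, M.PosDef → N.PosDef → rdist 1 N ≤ rdist 1 M + rdist M N := by
    intro M N hM hN
    have h1 := fnorm_mlog_sub_mlog_le_rdist hN hM
    have h2 := fnorm_add_le (mlog M) (mlog N - mlog M)
    rw [add_sub_cancel] at h2
    rw [rdist_one, rdist_one, rdist_comm hM hN]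
    linarith
  have hG := posDef_mpow hA (1 / 2)
  have e1 : mpow A (1 / 2) * 1 * star (mpow A (1 / 2)) = A := by
    rw [star_mpow hA, mul_one, mpow_half_mul_self hA]
  have e2 : ∀ B, mpow A (1 / 2) * relPos A B * star (mpow A (1 / 2)) = B := fun B => by
    rw [star_mpow hA, half_mul_relPos_mul_half hA]
  have hM := posDef_relPos hA hB
  have hN := posDef_relPos hA hC
  have := key _ _ hM hN
  rwa [← rdist_congruence .one hN hG.isUnit, ← rdist_congruence .one hM hG.isUnit,
    ← rdist_congruence hM hN hG.isUnit, e1, e2, e2] at this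

lemma rdist_mpow_le (hA : A.PosDef) (hB : B.PosDef) (ht : t ∈ Set.Icc (0 : ℝ) 1) :
    rdist (mpow A t) (mpow B t) ≤ t * rdist A B :=
  le_mul_rdist_of_sq_le (ρ := fun A B : Mat m => rdist (mpow A t) (mpow B t)) ht.1
    (fun _ _ _ hA hB hC => rdist_triangle (posDef_mpow hA t) (posDef_mpow hB t) (posDef_mpow hC t))
    (fun _ _ hA hB => (rdist_sq_le_traceDiv (posDef_mpow hA t) (posDef_mpow hB t)).trans
      (traceDiv_mpow_le hA hB ht)) hA hB

lemma rdist_geom_le (hA : A.PosDef) (hB : B.PosDef) (hC : C.PosDef) (ht : t ∈ Set.Icc (0 : ℝ) 1) :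
    rdist (geom A t B) (geom A t C) ≤ t * rdist B C := by
  have hG := (posDef_mpow hA (1 / 2)).isUnit
  have hM := posDef_relPos hA hB
  have hN := posDef_relPos hA hC
  have e1 : ∀ B, mpow A (1 / 2) * relPos A B * star (mpow A (1 / 2)) = B := fun B => by
    rw [star_mpow hA, half_mul_relPos_mul_half hA]
  have e2 : ∀ B, mpow A (1 / 2) * mpow (relPos A B) t * star (mpow A (1 / 2)) = geom A t B :=
    fun B => by rw [star_mpow hA, geom_eq_relPos]
  have := rdist_mpow_le hM hN ht
  rwa [← rdist_congruence hM hN hG, ← rdist_congruence (posDef_mpow hM t) (posDef_mpow hN t) hG,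
    e1, e1, e2, e2] at this

/-- Joint convexity of the trace metric along weighted geometric means. -/
lemma rdist_geom_geom_le (hX : X.PosDef) (hY : Y.PosDef) (hA : A.PosDef) (hB : B.PosDef)
    (ht : t ∈ Set.Icc (0 : ℝ) 1) (s : ℝ) :
    rdist (geom X t A) (geom Y s B) ≤
      (1 - t) * rdist X Y + t * rdist A B + |t - s| * rdist Y B := by
  have h1 := rdist_geom_le hX hA hB ht
  have h2 : rdist (geom X t B) (geom Y t B) ≤ (1 - t) * rdist X Y := by
    rw [geom_comm hX hB, geom_comm hY hB]
    exact rdist_geom_le hB hX hY ⟨by linarith [ht.2], by linarith [ht.1]⟩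
  have h3 := rdist_geom_geom hY hB t s
  have h4 := rdist_triangle (posDef_geom hX hA t) (posDef_geom hX hB t) (posDef_geom hY hB s)
  have h5 := rdist_triangle (posDef_geom hX hB t) (posDef_geom hY hB t) (posDef_geom hY hB s)
  rw [abs_sub_comm] at h3
  linarith

/-- The trace metric is continuous on pairs of positive definite matrices. -/
lemma continuousOn_rdist :
    ContinuousOn (fun p : Mat m × Mat m => rdist p.1 p.2) {p | p.1.PosDef ∧ p.2.PosDef} := by
  have hdiv : ∀ A : Mat m, A.PosDef → Filter.Tendsto (fun B => √(traceDiv A B)) (nhds A)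
      (nhds 0) := by
    intro A hA
    have hc : ContinuousAt (fun B => √(traceDiv A B)) A := by
      have hinv : ContinuousAt (fun B : Mat m => B⁻¹) A := by
        refine continuousAt_matrix_inv A ?_
        rw [Ring.inverse_eq_inv']
        exact continuousAt_inv₀ ((Matrix.isUnit_iff_isUnit_det A).1 hA.isUnit).ne_zero
      have htr : Continuous fun B : Mat m => B.trace.re :=
        Complex.continuous_re.comp continuous_id.matrix_trace
      refine ContinuousAt.sqrt (((htr.continuousAt.comp ?_).add
        (htr.continuousAt.comp (hinv.mul continuousAt_const))).sub continuousAt_const)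
      fun_prop
    have := hc.tendsto
    rwa [traceDiv_self hA, Real.sqrt_zero] at this
  rintro ⟨A, B⟩ ⟨hA, hB⟩
  rw [ContinuousWithinAt, tendsto_iff_dist_tendsto_zero]
  have hlim : Filter.Tendsto (fun p : Mat m × Mat m => √(traceDiv A p.1) + √(traceDiv B p.2))
      (nhdsWithin (A, B) {p | p.1.PosDef ∧ p.2.PosDef}) (nhds 0) := by
    have h1 := ((hdiv A hA).comp (continuous_fst.tendsto (A, B))).add
      ((hdiv B hB).comp (continuous_snd.tendsto (A, B)))
    rw [add_zero] at h1
    exact h1.mono_left nhdsWithin_le_nhds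
  refine squeeze_zero' (Filter.Eventually.of_forall fun _ => dist_nonneg) ?_ hlim
  filter_upwards [self_mem_nhdsWithin] with ⟨C, D⟩ ⟨hC, hD⟩
  have h1 := Real.le_sqrt_of_sq_le (rdist_sq_le_traceDiv hA hC)
  have h2 := Real.le_sqrt_of_sq_le (rdist_sq_le_traceDiv hB hD)
  have t1 := rdist_triangle hC hA hD
  have t2 := rdist_triangle hA hB hD
  have t3 := rdist_triangle hA hC hB
  have t4 := rdist_triangle hC hD hB
  rw [rdist_comm hC hA] at t1
  rw [rdist_comm hD hB] at t4
  rw [Real.dist_eq, abs_le]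
  constructor <;> dsimp only <;> linarith

end NonpositiveCurvature

section Wasserstein

variable {m : ℕ} {μ ν : Measure (Mat m)} {π : Measure (Mat m × Mat m)}

instance : SecondCountableTopology (Mat m) :=
  inferInstanceAs (SecondCountableTopology (Fin m → Fin m → ℂ))

instance : T2Space (Mat m) := inferInstanceAs (T2Space (Fin m → Fin m → ℂ))

lemma ae_fst_of_mem_couplings (hπ : π ∈ couplings μ ν) {p : Mat m → Prop}
    (h : ∀ᵐ A ∂μ, p A) : ∀ᵐ z ∂π, p z.1 := by
  rw [← hπ.2.1] at h
  exact ae_of_ae_map measurable_fst.aemeasurable h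

lemma ae_snd_of_mem_couplings (hπ : π ∈ couplings μ ν) {p : Mat m → Prop}
    (h : ∀ᵐ A ∂ν, p A) : ∀ᵐ z ∂π, p z.2 := by
  rw [← hπ.2.2] at h
  exact ae_of_ae_map measurable_snd.aemeasurable h

lemma aestronglyMeasurable_rdist (h : ∀ᵐ z ∂π, z.1.PosDef ∧ z.2.PosDef) :
    AEStronglyMeasurable (fun z => rdist z.1 z.2) π := by
  obtain ⟨S, hS, hSm, hS0⟩ := exists_measurable_superset_of_null h
  have hsub : Sᶜ ⊆ {z | z.1.PosDef ∧ z.2.PosDef} := Set.compl_subset_comm.1 hS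
  have hae : ∀ᵐ z ∂π, z ∈ Sᶜ := measure_eq_zero_iff_ae_notMem.1 hS0
  have := (continuousOn_rdist.mono hsub).aestronglyMeasurable (μ := π) hSm.compl
  rwa [Measure.restrict_eq_self_of_ae_mem hae] at this

lemma HasFFM.integrable (hμ : HasFFM μ) [IsFiniteMeasure μ] (hpos : ∀ᵐ A ∂μ, A.PosDef) {Y : Mat m}
    (hY : Y.PosDef) : Integrable (fun A => rdist Y A) μ := by
  obtain ⟨Z, hZ, hint⟩ := hμ
  have hmeas : AEStronglyMeasurable (fun A => rdist Y A) μ := by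
    have h : ∀ᵐ z ∂(μ.map (fun A => (Y, A))), z.1.PosDef ∧ z.2.PosDef := by
      obtain ⟨S, hS, hSm, hS0⟩ := exists_measurable_superset_of_null hpos
      have h1 : μ.map (fun A => (Y, A)) (Set.univ ×ˢ S) = 0 := by
        rw [Measure.map_apply measurable_prodMk_left (MeasurableSet.univ.prod hSm)]
        simpa using hS0
      have h2 : μ.map (fun A => (Y, A)) ({Y}ᶜ ×ˢ Set.univ) = 0 := by
        rw [Measure.map_apply measurable_prodMk_left
          ((measurableSet_singleton Y).compl.prod MeasurableSet.univ)]
        simp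
      filter_upwards [measure_eq_zero_iff_ae_notMem.1 h1, measure_eq_zero_iff_ae_notMem.1 h2]
        with z hz1 hz2
      have e : z.1 = Y := by simpa using hz2
      refine ⟨e ▸ hY, ?_⟩
      by_contra hc
      exact hz1 ⟨Set.mem_univ _, hS hc⟩
    exact (aestronglyMeasurable_rdist h).comp_measurable measurable_prodMk_left
  refine ((integrable_const (rdist Y Z)).add hint).mono' hmeas ?_
  filter_upwards [hpos] with A hA
  rw [Real.norm_of_nonneg (rdist_nonneg _ _), Pi.add_apply, rdist_comm hA hZ]
  exact rdist_triangle hY hZ hA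

lemma integral_snd_of_mem_couplings (hπ : π ∈ couplings μ ν) {f : Mat m → ℝ}
    (hf : AEStronglyMeasurable f ν) : ∫ z, f z.2 ∂π = ∫ B, f B ∂ν := by
  obtain ⟨-, -, rfl⟩ := hπ
  exact (integral_map measurable_snd.aemeasurable hf).symm

lemma integrable_rdist_of_mem_couplings (hπ : π ∈ couplings μ ν) (hμpos : ∀ᵐ A ∂μ, A.PosDef)
    (hνpos : ∀ᵐ B ∂ν, B.PosDef) {Y : Mat m} (hY : Y.PosDef)
    (hμint : Integrable (fun A => rdist Y A) μ) (hνint : Integrable (fun B => rdist Y B) ν) :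
    Integrable (fun z => rdist z.1 z.2) π := by
  have h1 := ae_fst_of_mem_couplings hπ hμpos
  have h2 := ae_snd_of_mem_couplings hπ hνpos
  rw [← hπ.2.1] at hμint
  rw [← hπ.2.2] at hνint
  refine ((hμint.comp_measurable measurable_fst).add
    (hνint.comp_measurable measurable_snd)).mono' (aestronglyMeasurable_rdist (h1.and h2)) ?_
  filter_upwards [h1, h2] with z hz1 hz2
  rw [Real.norm_of_nonneg (rdist_nonneg _ _), Pi.add_apply]
  have := rdist_triangle hz1 hY hz2
  rwa [rdist_comm hz1 hY] at this

lemma prod_mem_couplings (μ ν : Measure (Mat m)) [IsProbabilityMeasure μ]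
    [IsProbabilityMeasure ν] : μ.prod ν ∈ couplings μ ν :=
  ⟨inferInstance, by simp, by simp⟩

lemma map_prodMap_mem_couplings (hπ : π ∈ couplings μ ν) {f g : Mat m → Mat m}
    (hf : AEMeasurable f μ) (hg : AEMeasurable g ν) :
    π.map (Prod.map f g) ∈ couplings (μ.map f) (ν.map g) := by
  obtain ⟨hπ, rfl, rfl⟩ := hπ
  have hf' := hf.comp_measurable measurable_fst
  have hg' := hg.comp_measurable measurable_snd
  have hfg : AEMeasurable (Prod.map f g) π := hf'.prodMk hg'
  refine ⟨Measure.isProbabilityMeasure_map hfg, ?_, ?_⟩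
  · rw [AEMeasurable.map_map_of_aemeasurable measurable_fst.aemeasurable hfg,
      AEMeasurable.map_map_of_aemeasurable hf measurable_fst.aemeasurable]
    rfl
  · rw [AEMeasurable.map_map_of_aemeasurable measurable_snd.aemeasurable hfg,
      AEMeasurable.map_map_of_aemeasurable hg measurable_snd.aemeasurable]
    rfl

lemma integral_map_rdist_le {F : Mat m × Mat m → Mat m × Mat m} (hF : AEMeasurable F π) :
    ∫ z, rdist z.1 z.2 ∂(π.map F) ≤ ∫ z, rdist (F z).1 (F z).2 ∂π := by
  by_cases h : AEStronglyMeasurable (fun z => rdist z.1 z.2) (π.map F)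
  · exact (integral_map hF h).le
  · rw [integral_non_aestronglyMeasurable h]
    exact integral_nonneg fun z => rdist_nonneg _ _

lemma W1_le (hπ : π ∈ couplings μ ν) : W1 μ ν ≤ ∫ z, rdist z.1 z.2 ∂π := by
  refine csInf_le ⟨0, ?_⟩ ⟨π, hπ, rfl⟩
  rintro - ⟨π', -, rfl⟩
  exact integral_nonneg fun z => rdist_nonneg _ _

lemma W1_dirac [IsProbabilityMeasure ν] {Y : Mat m}
    (hint : Integrable (fun B => rdist Y B) ν) :
    W1 (Measure.dirac Y) ν = ∫ B, rdist Y B ∂ν := by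
  have h : ∀ π ∈ couplings (Measure.dirac Y) ν, ∫ z, rdist z.1 z.2 ∂π = ∫ B, rdist Y B ∂ν := by
    intro π hπ
    rw [← integral_snd_of_mem_couplings hπ hint.aestronglyMeasurable]
    refine integral_congr_ae ?_
    have : ∀ᵐ A ∂(Measure.dirac Y), A = Y := by
      rw [ae_dirac_eq]
      rfl
    filter_upwards [ae_fst_of_mem_couplings hπ this] with z hz
    rw [hz]
  have himg : (fun π : Measure (Mat m × Mat m) => ∫ z, rdist z.1 z.2 ∂π) ''
      couplings (Measure.dirac Y) ν = {∫ B, rdist Y B ∂ν} :=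
    Set.Subset.antisymm (by rintro - ⟨π, hπ, rfl⟩; exact h π hπ)
      (Set.singleton_subset_iff.2
        ⟨_, prod_mem_couplings _ _, h _ (prod_mem_couplings _ _)⟩)
  rw [W1, himg, csInf_singleton]

end Wasserstein

/-- `d₁^W(X #_t μ, Y #_s ν) ≤ (1-t) d(X,Y) + t d₁^W(μ,ν) + |t-s| d₁^W(δ_Y, ν)`. -/
theorem stmt12 {m : ℕ} (X Y : Mat m) (hX : X.PosDef) (hY : Y.PosDef)
    (μ ν : Measure (Mat m)) (hμ : IsProbabilityMeasure μ) (hν : IsProbabilityMeasure ν)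
    (hμpos : ∀ᵐ A ∂μ, A.PosDef) (hνpos : ∀ᵐ A ∂ν, A.PosDef)
    (hμffm : HasFFM μ) (hνffm : HasFFM ν) (t s : ℝ)
    (ht : t ∈ Set.Icc (0:ℝ) 1) (hs : s ∈ Set.Icc (0:ℝ) 1)
    (hm1 : AEMeasurable (geom X t) μ) (hm2 : AEMeasurable (geom Y s) ν) :
    W1 (μ.map (geom X t)) (ν.map (geom Y s)) ≤
      (1 - t) * rdist X Y + t * W1 μ ν + |t - s| * W1 (Measure.dirac Y) ν := by
  have hμint := hμffm.integrable hμpos hY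
  have hνint := hνffm.integrable hνpos hY
  have key : ∀ π ∈ couplings μ ν, W1 (μ.map (geom X t)) (ν.map (geom Y s)) ≤
      (1 - t) * rdist X Y + t * ∫ z, rdist z.1 z.2 ∂π + |t - s| * W1 (Measure.dirac Y) ν := by
    intro π hπ
    have hprob := hπ.1
    have h1 := ae_fst_of_mem_couplings hπ hμpos
    have h2 := ae_snd_of_mem_couplings hπ hνpos
    have hF : AEMeasurable (Prod.map (geom X t) (geom Y s)) π := by
      rw [← hπ.2.1] at hm1
      rw [← hπ.2.2] at hm2
      exact (hm1.comp_measurable measurable_fst).prodMk (hm2.comp_measurable measurable_snd)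
    have hint := integrable_rdist_of_mem_couplings hπ hμpos hνpos hY hμint hνint
    have hint' : Integrable (fun z : Mat m × Mat m => rdist Y z.2) π := by
      rw [← hπ.2.2] at hνint
      exact hνint.comp_measurable measurable_snd
    have hsum := ((integrable_const ((1 - t) * rdist X Y)).add (hint.const_mul t)).add
      (hint'.const_mul |t - s|)
    refine (W1_le (map_prodMap_mem_couplings hπ hm1 hm2)).trans
      ((integral_map_rdist_le hF).trans ?_)
    refine (integral_mono_of_nonneg (.of_forall fun z => rdist_nonneg _ _) hsum ?_).trans_eq ?_
    · filter_upwards [h1, h2] with z hz1 hz2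
      exact rdist_geom_geom_le hX hY hz1 hz2 ht s
    · rw [integral_add' ((integrable_const _).add (hint.const_mul t)) (hint'.const_mul _),
        integral_add' (integrable_const _) (hint.const_mul t), integral_const, integral_const_mul,
        integral_const_mul, W1_dirac hνint,
        integral_snd_of_mem_couplings hπ hνint.aestronglyMeasurable]
      simp
  refine le_of_forall_pos_le_add fun ε hε => ?_
  obtain ⟨-, ⟨π, hπ, rfl⟩, hlt⟩ := Real.lt_sInf_add_pos
    (Set.Nonempty.image (fun π : Measure (Mat m × Mat m) => ∫ z, rdist z.1 z.2 ∂π)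
      ⟨_, prod_mem_couplings μ ν⟩) hε
  have h1 := key π hπ
  have h2 : t * ∫ z, rdist z.1 z.2 ∂π ≤ t * W1 μ ν + ε :=
    calc _ ≤ t * (W1 μ ν + ε) := mul_le_mul_of_nonneg_left hlt.le ht.1
      _ ≤ t * W1 μ ν + ε := by nlinarith [ht.2]
  linarith
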